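/- For m ≥ 1 let F^{II}_m(q, t) = Σ_{σ ∈ AndII_m} t^{des(σ)} q^{inv(σ)} ∈ ℤ[q, t] be the descent–inversion polynomial of André II permutations of [m]. Then for every n ≥ 1, F^{II}_{n+1}(q, t) = F^{II}_n(q, t) + Σ_{k=0}^{n−2} q^{2(n−k−1)} [n−1 choose k]_q · F^{II}_{k+1}(q, t) · F^{II}_{n−k−1}(q, t), where the sum is empty when n = 1 and [n−1 choose k]_q is the Gaussian binomial coefficient. -/

import Mathlib

namespace PermStats

/-- The word of a permutation `σ` of `[n] = {1,…,n}` with the boundary convention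
`σ_0 = σ_{n+1} = 0`: position `i` (for `1 ≤ i ≤ n`) holds the value `σ(i) ∈ [n]`,
and every other position holds `0`. -/
def wval (n : ℕ) (σ : Equiv.Perm (Fin n)) (i : ℕ) : ℕ :=
  if h : 1 ≤ i ∧ i ≤ n then ((σ ⟨i - 1, by omega⟩ : Fin n) : ℕ) + 1 else 0

/-- `des(σ) = #{i : 0 ≤ i ≤ n, σ_i > σ_{i+1}}`. -/
def des (n : ℕ) (σ : Equiv.Perm (Fin n)) : ℕ :=
  ((Finset.range (n + 1)).filter fun i => wval n σ (i + 1) < wval n σ i).card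

/-- `asc(σ) = #{i : 0 ≤ i ≤ n, σ_i < σ_{i+1}}`. -/
def asc (n : ℕ) (σ : Equiv.Perm (Fin n)) : ℕ :=
  ((Finset.range (n + 1)).filter fun i => wval n σ i < wval n σ (i + 1)).card

/-- `inv(σ) = #{(i,j) : 1 ≤ i < j ≤ n, σ_i > σ_j}`. -/
def inv (n : ℕ) (σ : Equiv.Perm (Fin n)) : ℕ :=
  (Finset.univ.filter fun p : Fin n × Fin n => p.1 < p.2 ∧ σ p.2 < σ p.1).card

end PermStats

namespace Andre

/-- The word `σ(1) σ(2) ⋯ σ(n)` (with values in `[n] = {1,…,n}`) of a permutation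
`σ` of `[n]`. -/
def permWord (n : ℕ) (σ : Equiv.Perm (Fin n)) : List ℕ :=
  List.ofFn fun i : Fin n => ((σ i : Fin n) : ℕ) + 1

/-- André I permutations (as words of distinct positive integers): the empty word and
single letters are André I, and a word `w = τ m τ'` whose minimum letter is `m` is
André I when both `τ` and `τ'` are André I and the maximum letter of `τ τ'` lies
in `τ'`. -/
inductive IsAndreI : List ℕ → Prop where
  | nil : IsAndreI []
  | single (a : ℕ) : IsAndreI [a]
  | node (τ τ' : List ℕ) (m M : ℕ) :
      IsAndreI τ → IsAndreI τ' →
      (∀ a ∈ τ ++ τ', m < a) →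
      M ∈ τ' → (∀ a ∈ τ ++ τ', a ≤ M) →
      IsAndreI (τ ++ m :: τ')

/-- André II permutations (as words of distinct positive integers): the empty word and
single letters are André II, and a word `w = τ m τ'` whose minimum letter is `m` is
André II when both `τ` and `τ'` are André II and the minimum letter of `τ τ'` lies
in `τ'`. -/
inductive IsAndreII : List ℕ → Prop where
  | nil : IsAndreII []
  | single (a : ℕ) : IsAndreII [a]
  | node (τ τ' : List ℕ) (m m' : ℕ) :
      IsAndreII τ → IsAndreII τ' →
      (∀ a ∈ τ ++ τ', m < a) →
      m' ∈ τ' → (∀ a ∈ τ ++ τ', m' ≤ a) →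
      IsAndreII (τ ++ m :: τ')

/-- The set of André I permutations of `[n]`, as a finset of `Equiv.Perm (Fin n)`. -/
noncomputable def andreIFinset (n : ℕ) : Finset (Equiv.Perm (Fin n)) :=
  @Finset.filter _ (fun σ => IsAndreI (permWord n σ)) (Classical.decPred _) Finset.univ

/-- The set of André II permutations of `[n]`, as a finset of `Equiv.Perm (Fin n)`. -/
noncomputable def andreIIFinset (n : ℕ) : Finset (Equiv.Perm (Fin n)) :=
  @Finset.filter _ (fun σ => IsAndreII (permWord n σ)) (Classical.decPred _) Finset.univ

end Andre

/-- The Gaussian binomial coefficient `[n choose k]_q`, defined by the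
q-Pascal recurrence `[n+1, k+1] = [n, k] + q^{k+1}·[n, k+1]`; it equals
`((1-q^n)⋯(1-q^{n-k+1}))/((1-q^k)⋯(1-q))` for `0 ≤ k ≤ n` and `0` for `k > n`. -/
def qBinom {R : Type*} [CommRing R] (q : R) : ℕ → ℕ → R
  | _, 0 => 1
  | 0, _ + 1 => 0
  | n + 1, k + 1 => qBinom q n k + q ^ (k + 1) * qBinom q n (k + 1)

open PermStats Andre

/-- The descent–inversion polynomial
`F^{II}_m(q, t) = Σ_{σ ∈ AndII_m} t^{des σ} q^{inv σ}` of André II permutations of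
`[m]`, as an element of `ℤ[q][t] = Polynomial (Polynomial ℤ)` (`q` the inner and `t`
the outer variable). -/
noncomputable def FII (m : ℕ) : Polynomial (Polynomial ℤ) :=
  ∑ σ ∈ andreIIFinset m,
    Polynomial.X ^ des m σ * Polynomial.C (Polynomial.X ^ inv m σ)

namespace Andre

/-- Two words that are order-isomorphic letter by letter are simultaneously André II. -/
theorem IsAndreII.map_of_lt_iff {α : Type*} {f g : α → ℕ} {l : List α}
    (hfg : ∀ a ∈ l, ∀ b ∈ l, f a < f b ↔ g a < g b) (h : IsAndreII (l.map f)) :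
    IsAndreII (l.map g) := by
  generalize hw : l.map f = w at h
  induction h generalizing l with
  | nil =>
    obtain rfl := List.map_eq_nil_iff.1 hw
    exact .nil
  | single a =>
    obtain ⟨b, rfl, -⟩ := List.map_eq_singleton_iff.1 hw
    exact .single _
  | node τ τ' m m' _ _ hm hm' hle ih ih' =>
    obtain ⟨l₁, l₂, rfl, rfl, h₂⟩ := List.map_eq_append_iff.1 hw
    obtain ⟨x, l₃, rfl, rfl, rfl⟩ := List.map_eq_cons_iff.1 h₂
    obtain ⟨y, hy, rfl⟩ := List.mem_map.1 hm'
    rw [List.map_append, List.map_cons]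
    refine .node _ _ _ (g y) (ih (fun a ha b hb => hfg a (by simp [ha]) b (by simp [hb])) rfl)
      (ih' (fun a ha b hb => hfg a (by simp [ha]) b (by simp [hb])) rfl) ?_
      (List.mem_map_of_mem hy) ?_
    · intro a ha
      rw [← List.map_append] at ha hm
      obtain ⟨z, hz, rfl⟩ := List.mem_map.1 ha
      exact (hfg x (by simp) z (by simp at hz ⊢; tauto)).1 (hm _ (List.mem_map_of_mem hz))
    · intro a ha
      rw [← List.map_append] at ha hle
      obtain ⟨z, hz, rfl⟩ := List.mem_map.1 ha
      exact not_lt.1 fun hlt => not_lt.2 (hle _ (List.mem_map_of_mem hz))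
        ((hfg z (by simp at hz ⊢; tauto) y (by simp [hy])).2 hlt)

/-- The number of descents of a word of positive letters followed by a final `0`. -/
def wordDes : List ℕ → ℕ
  | [] => 0
  | [_] => 1
  | a :: b :: l => (if b < a then 1 else 0) + wordDes (b :: l)

/-- The number of inversions of a word. -/
def wordInv : List ℕ → ℕ
  | [] => 0
  | a :: l => l.countP (· < a) + wordInv l

theorem wordDes_map_of_lt_iff {α : Type*} {f g : α → ℕ} {l : List α}
    (hfg : ∀ a ∈ l, ∀ b ∈ l, f a < f b ↔ g a < g b) :
    wordDes (l.map f) = wordDes (l.map g) := by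
  induction l with
  | nil => rfl
  | cons a l ih =>
    have ih := ih fun x hx y hy => hfg x (by simp [hx]) y (by simp [hy])
    cases l with
    | nil => rfl
    | cons b l =>
      simp only [List.map_cons, wordDes] at ih ⊢
      rw [ih]
      simp only [hfg b (by simp) a (by simp)]

theorem wordInv_map_of_lt_iff {α : Type*} {f g : α → ℕ} {l : List α}
    (hfg : ∀ a ∈ l, ∀ b ∈ l, f a < f b ↔ g a < g b) :
    wordInv (l.map f) = wordInv (l.map g) := by
  induction l with
  | nil => rfl
  | cons a l ih =>
    have ih := ih fun x hx y hy => hfg x (by simp [hx]) y (by simp [hy])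
    simp only [List.map_cons, wordInv, ih, List.countP_map]
    congr 1
    refine List.countP_congr fun b hb => ?_
    simpa using hfg b (by simp [hb]) a (by simp)

theorem wordDes_append_cons {τ τ' : List ℕ} {m : ℕ} (hm : ∀ a ∈ τ ++ τ', m < a)
    (hτ' : τ' ≠ []) : wordDes (τ ++ m :: τ') = wordDes τ + wordDes τ' := by
  induction τ with
  | nil =>
    cases τ' with
    | nil => exact absurd rfl hτ'
    | cons b l =>
      have : ¬ b < m := not_lt.2 (hm b (by simp)).le
      simp [wordDes, this]
  | cons a τ ih =>
    have ih := ih fun x hx => hm x (by simp at hx ⊢; tauto)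
    cases τ with
    | nil =>
      have : m < a := hm a (by simp)
      simp only [List.nil_append, wordDes, zero_add] at ih
      simp [wordDes, ih, this]
    | cons b l =>
      simp only [List.cons_append, wordDes] at ih ⊢
      rw [ih, add_assoc]

theorem wordInv_append (l l' : List ℕ) :
    wordInv (l ++ l') = wordInv l + wordInv l' + (l.map fun a => l'.countP (· < a)).sum := by
  induction l with
  | nil => simp [wordInv]
  | cons a l ih =>
    simp only [List.cons_append, wordInv, ih, List.countP_append, List.map_cons, List.sum_cons]
    ring

/-- The number of pairs `(a, b) ∈ A × B` with `b < a`. -/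
def crossInv (A B : Finset ℕ) : ℕ := ∑ a ∈ A, (B.filter (· < a)).card

theorem sum_countP_eq_crossInv {l l' : List ℕ} (hl : l.Nodup) (hl' : l'.Nodup) :
    (l.map fun a => l'.countP (· < a)).sum = crossInv l.toFinset l'.toFinset := by
  rw [crossInv, List.sum_toFinset _ hl]
  congr 1
  refine List.map_congr_left fun a _ => ?_
  rw [List.countP_eq_length_filter, ← List.toFinset_card_of_nodup (hl'.filter _),
    List.toFinset_filter]
  simp

theorem crossInv_insert_right_of_lt {A B : Finset ℕ} {m : ℕ} (hA : ∀ a ∈ A, m < a)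
    (hB : m ∉ B) : crossInv A (insert m B) = A.card + crossInv A B := by
  rw [crossInv, crossInv, Finset.card_eq_sum_ones, ← Finset.sum_add_distrib]
  refine Finset.sum_congr rfl fun a ha => ?_
  rw [Finset.filter_insert, if_pos (hA a ha), Finset.card_insert_of_notMem (by simp [hB]), add_comm]

/-- The Gaussian binomial coefficient counts subsets by the number of inversions across. -/
theorem sum_powersetCard_pow_crossInv {R : Type*} [CommRing R] (q : R) (T : Finset ℕ) (k : ℕ) :
    ∑ B ∈ T.powersetCard k, q ^ crossInv (T \ B) B = qBinom q T.card k := by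
  induction T using Finset.induction_on_max generalizing k with
  | empty => cases k <;> simp [qBinom, crossInv]
  | insert x T hx ih =>
    have hxT : x ∉ T := fun h => lt_irrefl _ (hx x h)
    rw [Finset.card_insert_of_notMem hxT]
    cases k with
    | zero => simp [qBinom, crossInv]
    | succ k =>
      rw [Finset.powersetCard_succ_insert hxT, Finset.sum_union, Finset.sum_image, qBinom,
        ← ih, ← ih, add_comm, Finset.mul_sum]
      · congr 1
        · refine Finset.sum_congr rfl fun B hB => ?_
          have hBT := (Finset.mem_powersetCard.1 hB).1
          congr 1
          rw [show insert x T \ insert x B = T \ B by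
            ext a; simp only [Finset.mem_sdiff, Finset.mem_insert]; grind]
          refine Finset.sum_congr rfl fun a ha => ?_
          rw [Finset.filter_insert, if_neg]
          exact not_lt.2 (hx a (Finset.mem_sdiff.1 ha).1).le
        · refine Finset.sum_congr rfl fun B hB => ?_
          obtain ⟨hBT, hcard⟩ := Finset.mem_powersetCard.1 hB
          rw [← pow_add, Finset.insert_sdiff_of_notMem _ fun h => hxT (hBT h), crossInv,
            Finset.sum_insert (by simp [hxT]), Finset.filter_true_of_mem fun b hb => hx b (hBT hb),
            hcard, crossInv]
      · intro B hB B' hB' h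
        have hB := (Finset.mem_powersetCard.1 hB).1
        have hB' := (Finset.mem_powersetCard.1 hB').1
        rw [← Finset.erase_insert fun h => hxT (hB h), h, Finset.erase_insert fun h => hxT (hB' h)]
      · rw [Finset.disjoint_left]
        intro B hB hB'
        obtain ⟨B', -, rfl⟩ := Finset.mem_image.1 hB'
        exact hxT ((Finset.mem_powersetCard.1 hB).1 (by simp))

open Classical in
/-- The André II words whose set of letters is `S`. -/
noncomputable def andreWords (S : Finset ℕ) : Finset (List ℕ) :=
  S.val.lists.toFinset.filter IsAndreII

theorem mem_andreWords {S : Finset ℕ} {w : List ℕ} :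
    w ∈ andreWords S ↔ w.Nodup ∧ w.toFinset = S ∧ IsAndreII w := by
  have : S.val = ↑w ↔ w.Nodup ∧ w.toFinset = S := by
    constructor
    · intro h
      have hw : w.Nodup := by rw [← Multiset.coe_nodup, ← h]; exact S.nodup
      refine ⟨hw, Finset.val_injective ?_⟩
      rw [h, List.toFinset_val, hw.dedup]
    · rintro ⟨hw, rfl⟩
      rw [List.toFinset_val, hw.dedup]
  classical
  rw [andreWords, Finset.mem_filter, Multiset.mem_toFinset,
    Multiset.mem_lists_iff, ← and_assoc, ← this]
  rfl

/-- The descent–inversion generating function of the André II words on the letters `S`. -/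
noncomputable def andreSum {R : Type*} [CommRing R] (q t : R) (S : Finset ℕ) : R :=
  ∑ w ∈ andreWords S, t ^ wordDes w * q ^ wordInv w

theorem IsAndreII.exists_of_mem {w : List ℕ} (h : IsAndreII w) {m m' : ℕ} (hne : m < m')
    (hm : m ∈ w) (hm' : m' ∈ w) (hle : ∀ a ∈ w, a = m ∨ m' ≤ a) :
    ∃ τ τ', w = τ ++ m :: τ' ∧ IsAndreII τ ∧ IsAndreII τ' ∧ m' ∈ τ' := by
  cases h with
  | nil => simp at hm
  | single a => simp at hm hm'; omega
  | node τ τ' x y hτ hτ' hx hy hley =>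
    have hxm : x = m := by
      rcases hle x (by simp) with h | h
      · exact h
      · simp only [List.mem_append, List.mem_cons] at hm
        have := hx m
        simp only [List.mem_append] at this
        grind
    subst hxm
    refine ⟨τ, τ', rfl, hτ, hτ', ?_⟩
    have h₁ : y = x ∨ m' ≤ y := hle y (by simp [hy])
    have h₂ : x < y := hx y (by simp [hy])
    have h₃ : y ≤ m' := hley m' (by simp only [List.mem_append, List.mem_cons] at hm' ⊢; grind)
    rwa [show m' = y by omega]

theorem andreSum_insert_insert {R : Type*} [CommRing R] (q t : R) {T : Finset ℕ} {m m' : ℕ}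
    (hmm' : m < m') (hT : ∀ a ∈ T, m' < a) :
    andreSum q t (insert m (insert m' T)) =
      ∑ B ∈ T.powerset, q ^ (2 * (T \ B).card + crossInv (T \ B) B) *
        andreSum q t (insert m' B) * andreSum q t (T \ B) := by
  have hm'T : m' ∉ T := fun h => lt_irrefl _ (hT _ h)
  have hmT : m ∉ T := fun h => lt_asymm hmm' (hT _ h)
  have hrhs : ∀ B ∈ T.powerset, q ^ (2 * (T \ B).card + crossInv (T \ B) B) *
        andreSum q t (insert m' B) * andreSum q t (T \ B) =
      ∑ p ∈ andreWords (T \ B) ×ˢ andreWords (insert m' B),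
        t ^ wordDes (p.1 ++ m :: p.2) * q ^ wordInv (p.1 ++ m :: p.2) := by
    intro B hB
    rw [Finset.mem_powerset] at hB
    rw [andreSum, andreSum, mul_assoc, mul_comm (∑ w ∈ andreWords (insert m' B), _),
      Finset.sum_mul_sum, ← Finset.sum_product', Finset.mul_sum]
    refine Finset.sum_congr rfl fun p hp => ?_
    obtain ⟨h₁, h₂⟩ := Finset.mem_product.1 hp
    obtain ⟨hd₁, hs₁, -⟩ := mem_andreWords.1 h₁
    obtain ⟨hd₂, hs₂, -⟩ := mem_andreWords.1 h₂
    have hmem₁ : ∀ a, a ∈ p.1 ↔ a ∈ T \ B := fun a => by rw [← hs₁, List.mem_toFinset]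
    have hmem₂ : ∀ a, a ∈ p.2 ↔ a = m' ∨ a ∈ B := fun a => by
      rw [← List.mem_toFinset, hs₂, Finset.mem_insert]
    have hlt : ∀ a ∈ p.1 ++ p.2, m < a := by
      intro a ha
      rw [List.mem_append, hmem₁, hmem₂, Finset.mem_sdiff] at ha
      rcases ha with ha | rfl | ha
      · exact hmm'.trans (hT a ha.1)
      · exact hmm'
      · exact hmm'.trans (hT a (hB ha))
    have hm₂ : m ∉ p.2 := fun h => lt_irrefl _ (hlt m (by simp [h]))
    have hmin : p.2.countP (· < m) = 0 :=
      List.countP_eq_zero.2 fun a ha => by simpa using (hlt a (by simp [ha])).le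
    have hinv : wordInv (p.1 ++ m :: p.2) = wordInv p.1 + wordInv p.2 +
        (2 * (T \ B).card + crossInv (T \ B) B) := by
      rw [wordInv_append, sum_countP_eq_crossInv hd₁ (List.nodup_cons.2 ⟨hm₂, hd₂⟩),
        List.toFinset_cons, hs₁, hs₂, crossInv_insert_right_of_lt, crossInv_insert_right_of_lt,
        wordInv, hmin]
      · ring
      · exact fun a ha => hT a (Finset.mem_sdiff.1 ha).1
      · exact fun h => hm'T (hB h)
      · exact fun a ha => hmm'.trans (hT a (Finset.mem_sdiff.1 ha).1)
      · rw [← hs₂, List.mem_toFinset]; exact hm₂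
    rw [wordDes_append_cons hlt (List.ne_nil_of_mem ((hmem₂ m').2 (Or.inl rfl))), hinv]
    ring
  rw [Finset.sum_congr rfl hrhs, Finset.sum_sigma', andreSum]
  symm
  refine Finset.sum_bij (fun x _ => x.2.1 ++ m :: x.2.2) ?_ ?_ ?_ fun _ _ => rfl
  · rintro ⟨B, τ, τ'⟩ hx
    simp only [Finset.mem_sigma, Finset.mem_powerset, Finset.mem_product, mem_andreWords] at hx ⊢
    obtain ⟨hB, ⟨hd₁, hs₁, ha₁⟩, hd₂, hs₂, ha₂⟩ := hx
    have hmem₁ : ∀ a, a ∈ τ ↔ a ∈ T ∧ a ∉ B := fun a => by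
      rw [← Finset.mem_sdiff, ← hs₁, List.mem_toFinset]
    have hmem₂ : ∀ a, a ∈ τ' ↔ a = m' ∨ a ∈ B := fun a => by
      rw [← List.mem_toFinset, hs₂, Finset.mem_insert]
    refine ⟨?_, ?_, .node _ _ _ m' ha₁ ha₂ ?_ ((hmem₂ m').2 (Or.inl rfl)) ?_⟩
    · rw [List.nodup_append, List.nodup_cons]
      refine ⟨hd₁, ⟨?_, hd₂⟩, ?_⟩
      · rw [hmem₂]; rintro (h | h)
        · omega
        · exact hmT (hB h)
      · intro a ha b hb
        rw [List.mem_cons, hmem₂] at hb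
        rw [hmem₁] at ha
        rintro rfl
        grind
    · ext a
      have := @hB a
      simp only [List.mem_toFinset, List.mem_append, List.mem_cons, Finset.mem_insert, hmem₁, hmem₂]
      tauto
    · intro a ha
      rw [List.mem_append, hmem₁, hmem₂] at ha
      have := @hB a
      have := hT a
      grind
    · intro a ha
      rw [List.mem_append, hmem₁, hmem₂] at ha
      have := @hB a
      have := hT a
      grind
  · rintro ⟨B, τ, τ'⟩ hx ⟨B₂, τ₂, τ₂'⟩ hx₂ h
    simp only [Finset.mem_sigma, Finset.mem_powerset, Finset.mem_product, mem_andreWords]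
      at hx hx₂ h
    obtain ⟨hB, ⟨hd₁, hs₁, -⟩, -, hs₂, -⟩ := hx
    obtain ⟨hB₂, -, -, hs₂₂, -⟩ := hx₂
    have hτ : m ∉ τ := by
      rw [← List.mem_toFinset, hs₁]; exact fun h => hmT (Finset.mem_sdiff.1 h).1
    have hτ' : m ∉ τ' := by
      rw [← List.mem_toFinset, hs₂, Finset.mem_insert]
      exact fun h => h.elim hmm'.ne fun h => hmT (hB h)
    obtain ⟨rfl, -, rfl⟩ := (List.append_cons_inj_of_notMem hτ hτ').1 h
    have : B = B₂ := by
      rw [← Finset.erase_insert fun h => hm'T (hB h), ← hs₂, hs₂₂,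
        Finset.erase_insert fun h => hm'T (hB₂ h)]
    rw [this]
  · intro w hw
    obtain ⟨hd, hs, ha⟩ := mem_andreWords.1 hw
    have hmem : ∀ a, a ∈ w ↔ a = m ∨ a = m' ∨ a ∈ T := fun a => by
      rw [← List.mem_toFinset, hs, Finset.mem_insert, Finset.mem_insert]
    obtain ⟨τ, τ', rfl, hτ, hτ', hm'⟩ := ha.exists_of_mem hmm' ((hmem m).2 (Or.inl rfl))
      ((hmem m').2 (Or.inr (Or.inl rfl))) fun a ha => by
        rcases (hmem a).1 ha with h | h | h
        · exact Or.inl h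
        · exact Or.inr h.ge
        · exact Or.inr (hT a h).le
    rw [List.nodup_append, List.nodup_cons] at hd
    obtain ⟨hd₁, ⟨hmτ', hd₂⟩, hdis⟩ := hd
    simp only [List.mem_append, List.mem_cons] at hmem hdis
    refine ⟨⟨τ'.toFinset.erase m', τ, τ'⟩, ?_, rfl⟩
    simp only [Finset.mem_sigma, Finset.mem_powerset, Finset.mem_product, mem_andreWords]
    refine ⟨?_, ⟨hd₁, ?_, hτ⟩, hd₂, ?_, hτ'⟩
    · intro a ha
      rw [Finset.mem_erase, List.mem_toFinset] at ha
      grind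
    · ext a
      simp only [List.mem_toFinset, Finset.mem_sdiff, Finset.mem_erase]
      grind
    · rw [Finset.insert_erase (List.mem_toFinset.2 hm')]

theorem sum_range_descent_eq_wordDes {a : ℕ} {l : List ℕ} (h : ∀ b ∈ a :: l, 0 < b) :
    ∑ i ∈ Finset.range (l.length + 1),
      (if (a :: l).getD (i + 1) 0 < (a :: l).getD i 0 then 1 else 0) = wordDes (a :: l) := by
  induction l generalizing a with
  | nil =>
    have : 0 < a := h a (by simp)
    rw [List.length_nil, zero_add, Finset.sum_range_one]
    simp [wordDes, this]
  | cons b l ih =>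
    rw [List.length_cons, Finset.sum_range_succ', wordDes,
      ← ih fun x hx => h x (List.mem_cons_of_mem _ hx), add_comm]
    simp

theorem wval_eq_getD (n : ℕ) (σ : Equiv.Perm (Fin n)) (i : ℕ) :
    wval n σ i = (0 :: permWord n σ).getD i 0 := by
  cases i with
  | zero => simp [wval]
  | succ i =>
    by_cases h : i < n
    · simp [wval, permWord, h]
    · have : n ≤ i := not_lt.1 h
      simp [wval, permWord, h]

theorem des_eq_wordDes (n : ℕ) (σ : Equiv.Perm (Fin n)) :
    des n σ = wordDes (permWord n σ) := by
  have hlen : (permWord n σ).length = n := by simp [permWord]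
  have hpos : ∀ b ∈ permWord n σ, 0 < b := by
    intro b hb
    obtain ⟨i, rfl⟩ := (List.mem_ofFn' _ _).1 hb
    exact Nat.succ_pos _
  rw [des, Finset.card_filter]
  simp only [wval_eq_getD]
  generalize permWord n σ = w at hlen hpos
  subst hlen
  cases w with
  | nil => simp [wordDes]
  | cons a l =>
    rw [Finset.sum_range_succ', ← sum_range_descent_eq_wordDes hpos]
    simp

theorem countP_ofFn_eq_sum {α : Type*} {n : ℕ} (p : α → Prop) [DecidablePred p] (f : Fin n → α) :
    (List.ofFn f).countP p = ∑ i, if p (f i) then 1 else 0 := by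
  induction n with
  | zero => simp
  | succ n ih =>
    rw [List.ofFn_succ, List.countP_cons, ih, Fin.sum_univ_succ, add_comm]
    simp

theorem card_inversions_eq_wordInv {n : ℕ} (f : Fin n → ℕ) :
    (Finset.univ.filter fun p : Fin n × Fin n => p.1 < p.2 ∧ f p.2 < f p.1).card =
      wordInv (List.ofFn f) := by
  induction n with
  | zero => simp [wordInv]
  | succ n ih =>
    rw [List.ofFn_succ, wordInv, ← ih, Finset.card_filter, Finset.card_filter,
      Fintype.sum_prod_type, Fintype.sum_prod_type, Fin.sum_univ_succ]
    congr 1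
    · rw [countP_ofFn_eq_sum, Fin.sum_univ_succ]
      simp
    · refine Finset.sum_congr rfl fun i _ => ?_
      rw [Fin.sum_univ_succ]
      simp

theorem mem_andreIIFinset {n : ℕ} {σ : Equiv.Perm (Fin n)} :
    σ ∈ andreIIFinset n ↔ IsAndreII (permWord n σ) := by
  simp [andreIIFinset]

theorem FII_eq_andreSum (S : Finset ℕ) :
    FII S.card = andreSum (Polynomial.C (Polynomial.X : Polynomial ℤ)) Polynomial.X S := by
  generalize hn : S.card = n
  have hword : ∀ σ : Equiv.Perm (Fin n),
      permWord n σ = (List.ofFn σ).map fun i : Fin n => (i : ℕ) + 1 := fun σ => by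
    rw [List.map_ofFn]; rfl
  set e := S.orderEmbOfFin hn with he
  have hlt : ∀ i j : Fin n, (i : ℕ) + 1 < (j : ℕ) + 1 ↔ e i < e j := fun i j => by
    rw [e.lt_iff_lt, Fin.lt_def]; omega
  refine Finset.sum_bij (fun σ _ => (List.ofFn σ).map e) ?_ ?_ ?_ ?_
  · intro σ hσ
    rw [mem_andreIIFinset, hword] at hσ
    refine mem_andreWords.2 ⟨(List.nodup_ofFn.2 σ.injective).map e.injective, ?_,
      hσ.map_of_lt_iff fun i _ j _ => hlt i j⟩
    ext a
    rw [List.mem_toFinset, ← Finset.mem_coe, ← S.range_orderEmbOfFin hn, ← he, List.map_ofFn,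
      List.mem_ofFn', σ.surjective.range_comp]
  · intro σ _ σ' _ h
    exact DFunLike.coe_injective (List.ofFn_injective (List.map_injective_iff.2 e.injective h))
  · intro w hw
    obtain ⟨hd, hs, ha⟩ := mem_andreWords.1 hw
    have hlen : w.length = n := by rw [← hn, ← hs, List.toFinset_card_of_nodup hd]
    have hex : ∀ i : Fin n, ∃ j, e j = w[i] := fun i => by
      have : w[i] ∈ (S : Set ℕ) := by rw [← hs]; simp
      rwa [← S.range_orderEmbOfFin hn] at this
    choose g hg using hex
    have hginj : Function.Injective g := fun i j hij => by
      have := congrArg e hij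
      rw [hg, hg] at this
      exact Fin.ext ((hd.getElem_inj_iff).1 this)
    let σ : Equiv.Perm (Fin n) := Equiv.ofBijective g (Finite.injective_iff_bijective.1 hginj)
    have hσ : (List.ofFn σ).map e = w := by
      refine List.ext_getElem (by simp [hlen]) fun i h₁ h₂ => ?_
      simpa [σ] using hg ⟨i, hlen ▸ h₂⟩
    refine ⟨σ, ?_, hσ⟩
    rw [mem_andreIIFinset, hword]
    refine IsAndreII.map_of_lt_iff (f := e) (fun i _ j _ => (hlt i j).symm) ?_
    rwa [hσ]
  · intro σ _
    have hinv : inv n σ = wordInv (permWord n σ) := by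
      rw [permWord, ← card_inversions_eq_wordInv, inv]
      simp
    rw [des_eq_wordDes, hinv, hword, wordDes_map_of_lt_iff fun i _ j _ => hlt i j,
      wordInv_map_of_lt_iff fun i _ j _ => hlt i j, Polynomial.C_pow]

end Andre

theorem qBinom_eq_zero_of_lt {R : Type*} [CommRing R] (q : R) {n k : ℕ} (h : n < k) :
    qBinom q n k = 0 := by
  induction n generalizing k with
  | zero => obtain ⟨k, rfl⟩ := Nat.exists_eq_succ_of_ne_zero h.ne'; rfl
  | succ n ih =>
    obtain ⟨k, rfl⟩ := Nat.exists_eq_succ_of_ne_zero (Nat.ne_zero_of_lt h)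
    rw [Nat.succ_eq_add_one, qBinom, ih (by omega), ih (by omega)]
    simp

theorem qBinom_self {R : Type*} [CommRing R] (q : R) (n : ℕ) : qBinom q n n = 1 := by
  induction n with
  | zero => rfl
  | succ n ih => rw [qBinom, ih, qBinom_eq_zero_of_lt q (Nat.lt_succ_self n)]; simp

theorem map_qBinom {R R' : Type*} [CommRing R] [CommRing R'] (f : R →+* R') (q : R) (n k : ℕ) :
    f (qBinom q n k) = qBinom (f q) n k := by
  induction n generalizing k with
  | zero => cases k <;> simp [qBinom]
  | succ n ih => cases k <;> simp [qBinom, ih]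

theorem FII_zero : FII 0 = 1 := by
  have : andreIIFinset 0 = {1} := by
    ext σ
    simp [andreIIFinset, permWord, IsAndreII.nil, Subsingleton.elim σ 1]
  rw [FII, this, Finset.sum_singleton]
  have : des 0 1 = 0 := des_eq_wordDes 0 1
  simp [this, inv]

/-- the recurrence
`F^{II}_{n+1} = F^{II}_n + Σ_{k=0}^{n−2} q^{2(n−k−1)}·[n−1 choose k]_q·F^{II}_{k+1}·F^{II}_{n−k−1}`. -/
theorem FII_recurrence (n : ℕ) (hn : 1 ≤ n) :
    FII (n + 1) =
      FII n + ∑ k ∈ Finset.range (n - 1),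
        Polynomial.C (Polynomial.X ^ (2 * (n - k - 1)) *
            qBinom (Polynomial.X : Polynomial ℤ) (n - 1) k) *
          FII (k + 1) * FII (n - k - 1) := by
  have hT : ∀ a ∈ Finset.Ico 2 (n + 1), 1 < a := fun a ha => (Finset.mem_Ico.1 ha).1
  have hcard : (Finset.Ico 2 (n + 1)).card = n - 1 := by simp
  have hS : (insert 0 (insert 1 (Finset.Ico 2 (n + 1)))).card = n + 1 := by
    rw [Finset.card_insert_of_notMem (by simp), Finset.card_insert_of_notMem (by simp), hcard]
    omega
  have hterm : ∀ k ∈ Finset.range (n - 1 + 1),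
      ∑ B ∈ (Finset.Ico 2 (n + 1)).powersetCard k,
        (Polynomial.C Polynomial.X : Polynomial (Polynomial ℤ)) ^
            (2 * (Finset.Ico 2 (n + 1) \ B).card + crossInv (Finset.Ico 2 (n + 1) \ B) B) *
          andreSum (Polynomial.C (Polynomial.X : Polynomial ℤ)) Polynomial.X (insert 1 B) *
          andreSum (Polynomial.C (Polynomial.X : Polynomial ℤ)) Polynomial.X (Finset.Ico 2 (n + 1) \ B) =
      Polynomial.C (Polynomial.X ^ (2 * (n - k - 1)) *
          qBinom (Polynomial.X : Polynomial ℤ) (n - 1) k) *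
        FII (k + 1) * FII (n - k - 1) := by
    intro k _
    rw [Polynomial.C_mul, Polynomial.C_pow, map_qBinom, ← hcard, ← sum_powersetCard_pow_crossInv,
      Finset.mul_sum, Finset.sum_mul, Finset.sum_mul]
    refine Finset.sum_congr rfl fun B hB => ?_
    obtain ⟨hBT, hBk⟩ := Finset.mem_powersetCard.1 hB
    have h₁ : (insert 1 B).card = k + 1 := by
      rw [Finset.card_insert_of_notMem fun h => lt_irrefl _ (hT 1 (hBT h)), hBk]
    have h₂ : (Finset.Ico 2 (n + 1) \ B).card = n - k - 1 := by
      rw [Finset.card_sdiff_of_subset hBT, hcard, hBk]; omega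
    rw [← FII_eq_andreSum, ← FII_eq_andreSum, h₁, h₂, pow_add]
  rw [← hS, FII_eq_andreSum, andreSum_insert_insert _ _ zero_lt_one hT, Finset.sum_powerset, hcard,
    Finset.sum_congr rfl hterm, Finset.sum_range_succ, add_comm, qBinom_self,
    show n - (n - 1) - 1 = 0 by omega, FII_zero, Nat.sub_add_cancel hn]
  simp
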